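/- Let (W,S) be an irreducible Coxeter system that is not locally finite, i.e., there exists a proper subset J ⊊ S with W_J infinite. Then the right weak order on W contains an infinite antichain. -/

import Mathlib

/-- The right weak order on a Coxeter group: `v ≤_R w` iff `ℓ(v) + ℓ(v⁻¹w) = ℓ(w)`. -/
def weakLE {B : Type*} {W : Type*} [Group W] {M : CoxeterMatrix B}
    (cs : CoxeterSystem M W) (v w : W) : Prop :=
  cs.length v + cs.length (v⁻¹ * w) = cs.length w

namespace CoxeterSystem

open Polynomial.Chebyshev

variable {B W : Type*} [Group W] {M : CoxeterMatrix B} (cs : CoxeterSystem M W)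

section Geometric

/-- The row of the (doubled) cosine matrix of a Coxeter matrix indexed by `i`. -/
noncomputable def cosRow (M : CoxeterMatrix B) (i : B) : B → ℝ :=
  fun j ↦ -2 * Real.cos (Real.pi / M i j)

theorem cosRow_self (M : CoxeterMatrix B) (i : B) :
    LinearMap.proj (R := ℝ) (φ := fun _ : B ↦ ℝ) i (cosRow M i) = 2 := by
  simp [cosRow]

theorem eq_two_of_cosRow_eq_zero {i j : B} (h : cosRow M i j = 0) : M i j = 2 := by
  by_contra h2
  have hcos : Real.cos (Real.pi / M i j) = 0 := by simpa [cosRow] using h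
  obtain h0 | h1 | h3 : M i j = 0 ∨ M i j = 1 ∨ 3 ≤ M i j := by omega
  · simp [h0] at hcos
  · simp [h1] at hcos
  · have h3' : (3 : ℝ) ≤ M i j := by exact_mod_cast h3
    have hpos : 0 < Real.pi / M i j := by positivity
    have hlt : Real.pi / M i j < Real.pi / 2 :=
      div_lt_div_of_pos_left Real.pi_pos (by norm_num) (by linarith)
    exact (Real.cos_pos_of_mem_Ioo ⟨by linarith, hlt⟩).ne' hcos

theorem sin_mul_S_eval_two_mul_cos (θ : ℝ) (k : ℤ) :
    Real.sin θ * (S ℝ k).eval (2 * Real.cos θ) = Real.sin ((k + 1) * θ) := by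
  have h := U_real_cos θ k
  rw [← S_comp_two_mul_X] at h
  simpa [mul_comm] using h

/-- The contragredient of the geometric representation, on simple reflections. -/
noncomputable def dualReflection (M : CoxeterMatrix B) (i : B) : (B → ℝ) ≃ₗ[ℝ] (B → ℝ) :=
  Module.reflection (cosRow_self M i)

theorem dualReflection_apply (i : B) (φ : B → ℝ) :
    dualReflection M i φ = φ - φ i • cosRow M i := by
  simp [dualReflection, Module.reflection_apply]

theorem dualReflection_isLiftable : M.IsLiftable (dualReflection M) := by
  intro i j
  have hsymm : cosRow M j i = cosRow M i j := by simp [cosRow, M.symmetric i j]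
  obtain h0 | h1 | h2 | h3 : M i j = 0 ∨ M i j = 1 ∨ M i j = 2 ∨ 3 ≤ M i j := by omega
  · rw [h0, pow_zero]
  · obtain rfl : i = j := by
      by_contra hij
      exact M.off_diagonal i j hij h1
    rw [h1, pow_one]
    ext1 φ
    exact Module.involutive_reflection _ φ
  · have hij : cosRow M i j = 0 := by simp [cosRow, h2]
    have hii : cosRow M i i = 2 := cosRow_self M i
    have hjj : cosRow M j j = 2 := cosRow_self M j
    rw [h2]
    ext φ b
    simp only [pow_two, LinearEquiv.mul_apply, dualReflection_apply, Pi.sub_apply, Pi.smul_apply,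
      smul_eq_mul, hij, hsymm, hii, hjj, LinearEquiv.coe_one, id_eq]
    ring
  · set m := M i j with hm
    set θ : ℝ := 2 * Real.pi / m with hθ
    have h3' : (3 : ℝ) ≤ m := by exact_mod_cast h3
    have hm0 : (m : ℝ) ≠ 0 := by positivity
    have hsin : Real.sin θ ≠ 0 := by
      refine (Real.sin_pos_of_pos_of_lt_pi (by positivity) ?_).ne'
      rw [hθ, div_lt_iff₀ (by positivity)]
      nlinarith [Real.pi_pos]
    have ht : 2 * Real.cos θ = LinearMap.proj (R := ℝ) (φ := fun _ : B ↦ ℝ) i (cosRow M j) *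
        LinearMap.proj (R := ℝ) (φ := fun _ : B ↦ ℝ) j (cosRow M i) - 2 := by
      have : θ = 2 * (Real.pi / m) := by rw [hθ]; ring
      rw [LinearMap.proj_apply, LinearMap.proj_apply, hsymm, this, Real.cos_two_mul, cosRow, ← hm]
      ring
    have key : ∀ k : ℤ, (k + 1) * 2 = (m : ℤ) → (S ℝ k).eval (2 * Real.cos θ) = 0 := by
      intro k hk
      apply (mul_eq_zero.mp _).resolve_left hsin
      rw [sin_mul_S_eval_two_mul_cos]
      have hk' : ((k : ℝ) + 1) * 2 = m := by exact_mod_cast hk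
      rw [show ((k : ℝ) + 1) * θ = Real.pi by rw [hθ]; field_simp; linarith]
      exact Real.sin_pi
    have key' : ∀ k : ℤ, 2 * k + 1 = (m : ℤ) →
        (S ℝ k).eval (2 * Real.cos θ) + (S ℝ (k - 1)).eval (2 * Real.cos θ) = 0 := by
      intro k hk
      apply (mul_eq_zero.mp _).resolve_left hsin
      rw [mul_add, sin_mul_S_eval_two_mul_cos, sin_mul_S_eval_two_mul_cos]
      have hk' : 2 * (k : ℝ) + 1 = m := by exact_mod_cast hk
      have : ((k : ℝ) + 1) * θ = 2 * Real.pi - k * θ := by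
        rw [hθ]; field_simp; linarith
      rw [this, Real.sin_two_pi_sub]
      push_cast
      simp
    ext1 φ
    rw [dualReflection, dualReflection, Module.reflection_mul_reflection_pow_apply _ _ _ _ _ ht]
    obtain ⟨k, hk | hk⟩ := Int.even_or_odd' (m : ℤ)
    · rw [show ((m : ℤ) - 2) / 2 = k - 1 by omega, show ((m : ℤ) - 1) / 2 = k - 1 by omega,
        key (k - 1) (by omega)]
      simp
    · rw [show ((m : ℤ) - 2) / 2 = k - 1 by omega, show ((m : ℤ) - 1) / 2 = k by omega,
        show ((m : ℤ) - 3) / 2 = k - 1 by omega, show (m : ℤ) / 2 = k by omega,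
        key' k (by omega)]
      simp

/-- The contragredient of the geometric representation of a Coxeter group. -/
noncomputable def dualGeometricRep : W →* ((B → ℝ) ≃ₗ[ℝ] (B → ℝ)) :=
  cs.lift ⟨dualReflection M, dualReflection_isLiftable⟩

theorem dualGeometricRep_simple (i : B) (φ : B → ℝ) :
    cs.dualGeometricRep (cs.simple i) φ = φ - φ i • cosRow M i := by
  rw [dualGeometricRep, lift_apply_simple, dualReflection_apply]

theorem simple_injective : Function.Injective cs.simple := by
  classical
  intro i j h
  by_contra hij
  have h1 := cs.dualGeometricRep_simple i (Pi.single i 1)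
  rw [h, dualGeometricRep_simple] at h1
  have h2 := congrFun h1 i
  have h3 : cosRow M i i = 2 := cosRow_self M i
  norm_num [Ne.symm hij, h3] at h2

theorem dualGeometricRep_apply_of_mem_closure {J : Set B} {φ : B → ℝ} (hφ : ∀ j ∈ J, φ j = 0)
    {w : W} (hw : w ∈ Subgroup.closure (cs.simple '' J)) : cs.dualGeometricRep w φ = φ := by
  induction hw using Subgroup.closure_induction with
  | mem x hx =>
    obtain ⟨j, hj, rfl⟩ := hx
    simp [dualGeometricRep_simple, hφ j hj]
  | one => simp
  | mul x y _ _ hx hy => rw [map_mul, LinearEquiv.mul_apply, hy, hx]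
  | inv x _ hx =>
    rw [map_inv]
    exact (LinearEquiv.symm_apply_eq _).mpr hx.symm

theorem simple_mem_closure_iff {J : Set B} {i : B} :
    cs.simple i ∈ Subgroup.closure (cs.simple '' J) ↔ i ∈ J := by
  classical
  refine ⟨fun h ↦ ?_, fun h ↦ Subgroup.subset_closure ⟨i, h, rfl⟩⟩
  by_contra hi
  have h1 := cs.dualGeometricRep_apply_of_mem_closure (φ := Pi.single i 1)
    (fun j hj ↦ Pi.single_eq_of_ne (fun hji : j = i ↦ hi (hji ▸ hj)) _) h
  rw [dualGeometricRep_simple] at h1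
  have h2 := congrFun h1 i
  have h3 : cosRow M i i = 2 := cosRow_self M i
  simp [h3] at h2

theorem eq_two_of_conj_simple_mem_closure {J : Set B} {i j : B} (hi : i ∉ J) (hij : i ≠ j)
    (h : cs.simple i * cs.simple j * cs.simple i ∈ Subgroup.closure (cs.simple '' J)) :
    M i j = 2 := by
  classical
  set φ : B → ℝ := Pi.single i 1 with hφ
  have h1 := cs.dualGeometricRep_apply_of_mem_closure (φ := φ)
    (fun k hk ↦ Pi.single_eq_of_ne (fun hki : k = i ↦ hi (hki ▸ hk)) _) h
  have h2 : cs.dualGeometricRep (cs.simple j) (cs.dualGeometricRep (cs.simple i) φ) =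
      cs.dualGeometricRep (cs.simple i) φ := by
    conv_rhs => rw [← h1]
    simp only [← LinearEquiv.mul_apply, ← map_mul, ← mul_assoc, simple_mul_simple_self, one_mul]
  rw [dualGeometricRep_simple, dualGeometricRep_simple] at h2
  have h3 := congrFun h2 j
  have h4 : cosRow M j j = 2 := cosRow_self M j
  exact eq_two_of_cosRow_eq_zero (by simpa [hφ, h4, hij, hij.symm] using h3)

theorem simple_commute_of_eq_two {i j : B} (h : M i j = 2) :
    cs.simple i * cs.simple j * cs.simple i = cs.simple j := by
  have h1 := cs.simple_mul_simple_pow i j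
  rw [h, pow_two, ← mul_assoc] at h1
  rw [eq_inv_of_mul_eq_one_left h1, inv_simple]

end Geometric

section Inversions

open scoped Classical in
/-- The action of a simple reflection on signed group elements. Iterating it counts, modulo `2`,
the occurrences of an element in the right inversion sequence of a word. -/
noncomputable def signedConj (i : B) : Function.End (W × ZMod 2) :=
  fun x ↦ (cs.simple i * x.1 * cs.simple i, x.2 + if x.1 = cs.simple i then 1 else 0)

open scoped Classical in
theorem signedConj_mul_pow_apply (i j : B) (k : ℕ) (x : W × ZMod 2) :
    ((cs.signedConj i * cs.signedConj j) ^ k) x =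
      ((cs.simple i * cs.simple j) ^ k * x.1 * ((cs.simple i * cs.simple j) ^ k)⁻¹,
        x.2 + ∑ l ∈ Finset.range (2 * k),
          if x.1 = ((cs.simple i * cs.simple j) ^ l)⁻¹ * cs.simple j then 1 else 0) := by
  induction k with
  | zero => simp [Function.End.one_def]
  | succ k ih =>
    set p := cs.simple i * cs.simple j with hp
    have hinv : cs.simple j * cs.simple i = p⁻¹ := by simp [hp]
    have hconj : ∀ n : ℕ, cs.simple j * p ^ n = (p ^ n)⁻¹ * cs.simple j := by
      intro n
      induction n with
      | zero => simp
      | succ n ihn =>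
        have hj : cs.simple j * p = p⁻¹ * cs.simple j := by rw [← hinv, hp, mul_assoc]
        rw [pow_succ, ← mul_assoc, ihn, mul_assoc, hj, ← mul_assoc, ← mul_inv_rev, ← pow_succ',
          pow_succ]
    have e1 : p ^ k * x.1 * (p ^ k)⁻¹ = cs.simple j ↔ x.1 = (p ^ (2 * k))⁻¹ * cs.simple j := by
      rw [mul_inv_eq_iff_eq_mul, hconj, ← eq_inv_mul_iff_mul_eq, ← mul_assoc, two_mul, pow_add,
        mul_inv_rev]
    have e2 : cs.simple j * (p ^ k * x.1 * (p ^ k)⁻¹) * cs.simple j = cs.simple i ↔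
        x.1 = (p ^ (2 * k + 1))⁻¹ * cs.simple j := by
      have : cs.simple j * (p ^ k * x.1 * (p ^ k)⁻¹) * cs.simple j = cs.simple i ↔
          p ^ k * x.1 * (p ^ k)⁻¹ = p⁻¹ * cs.simple j := by
        rw [← hinv]
        constructor
        · intro h; rw [← h]; simp [mul_assoc]
        · intro h; rw [h]; simp [mul_assoc]
      rw [this, mul_inv_eq_iff_eq_mul, mul_assoc, hconj, ← eq_inv_mul_iff_mul_eq]
      have hpow : p ^ (2 * k + 1) = p ^ k * p * p ^ k := by
        rw [← pow_succ, ← pow_add]; congr 1; ring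
      rw [hpow]
      simp only [mul_inv_rev, mul_assoc]
    rw [pow_succ', show (cs.signedConj i * cs.signedConj j * (cs.signedConj i * cs.signedConj j) ^ k) x
      = cs.signedConj i (cs.signedConj j (((cs.signedConj i * cs.signedConj j) ^ k) x)) from rfl, ih]
    simp only [signedConj, e1, e2]
    rw [show 2 * (k + 1) = 2 * k + 1 + 1 by ring, Finset.sum_range_succ, Finset.sum_range_succ,
      ← add_assoc, ← add_assoc]
    congr 1
    rw [pow_succ', mul_inv_rev, ← hinv, hp]
    simp only [mul_assoc]

theorem signedConj_isLiftable : M.IsLiftable cs.signedConj := by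
  classical
  intro i j
  funext x
  rw [signedConj_mul_pow_apply, two_mul, Finset.sum_range_add]
  simp only [pow_add, simple_mul_simple_pow, one_mul, inv_one, mul_one, CharTwo.add_self_eq_zero,
    add_zero]
  rfl

/-- The action of a Coxeter group on signed group elements. -/
noncomputable def signedAction : W →* Function.End (W × ZMod 2) :=
  cs.lift ⟨cs.signedConj, cs.signedConj_isLiftable⟩

/-- The parity of the number of occurrences of `t` in the right inversion sequence of any word
representing `w`. -/
noncomputable def inversionParity (w t : W) : ZMod 2 := (cs.signedAction w (t, 0)).2

theorem signedAction_apply (w : W) (x : W × ZMod 2) :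
    cs.signedAction w x = (w * x.1 * w⁻¹, x.2 + cs.inversionParity w x.1) := by
  induction w using cs.simple_induction_left generalizing x with
  | one =>
    simp [inversionParity, Function.End.one_def]
  | mul_simple_left w i ih =>
    have h (y : W × ZMod 2) : cs.signedAction (cs.simple i * w) y =
        cs.signedConj i (cs.signedAction w y) := by
      rw [map_mul, signedAction, lift_apply_simple]
      rfl
    rw [inversionParity, h, h, ih, ih (x.1, 0)]
    simp [signedConj, mul_assoc, add_assoc]

theorem inversionParity_one (t : W) : cs.inversionParity 1 t = 0 := by
  simp [inversionParity, Function.End.one_def]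

open scoped Classical in
theorem inversionParity_simple (i : B) (t : W) :
    cs.inversionParity (cs.simple i) t = if t = cs.simple i then 1 else 0 := by
  simp [inversionParity, signedAction, signedConj]

theorem inversionParity_mul (w w' t : W) : cs.inversionParity (w * w') t =
    cs.inversionParity w' t + cs.inversionParity w (w' * t * w'⁻¹) := by
  rw [inversionParity, map_mul, show (cs.signedAction w * cs.signedAction w') (t, 0) =
    cs.signedAction w (cs.signedAction w' (t, 0)) from rfl, signedAction_apply, signedAction_apply]
  simp

theorem mem_rightInvSeq_of_inversionParity_ne_zero {ω : List B} {t : W}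
    (h : cs.inversionParity (cs.wordProd ω) t ≠ 0) : t ∈ cs.rightInvSeq ω := by
  classical
  induction ω with
  | nil => simp [inversionParity_one] at h
  | cons i ω ih =>
    rw [wordProd_cons, inversionParity_mul, inversionParity_simple] at h
    rw [rightInvSeq, List.mem_cons]
    by_cases ht : cs.wordProd ω * t * (cs.wordProd ω)⁻¹ = cs.simple i
    · left
      rw [← ht]
      group
    · right
      rw [if_neg ht, add_zero] at h
      exact ih h

theorem length_mul_lt_of_inversionParity_ne_zero {w t : W} (h : cs.inversionParity w t ≠ 0) :
    cs.length (w * t) < cs.length w := by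
  obtain ⟨ω, hω, rfl⟩ := cs.exists_isReduced w
  exact (cs.isRightInversion_of_mem_rightInvSeq hω
    (cs.mem_rightInvSeq_of_inversionParity_ne_zero h)).2

theorem isRightDescent_iff_inversionParity_ne_zero {w : W} {i : B} :
    cs.IsRightDescent w i ↔ cs.inversionParity w (cs.simple i) ≠ 0 := by
  refine ⟨fun h h0 ↦ ?_, cs.length_mul_lt_of_inversionParity_ne_zero⟩
  have h1 : cs.inversionParity (w * cs.simple i) (cs.simple i) ≠ 0 := by
    rw [inversionParity_mul, inversionParity_simple]
    simp [h0]
  have h2 := cs.length_mul_lt_of_inversionParity_ne_zero h1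
  rw [simple_mul_simple_cancel_right] at h2
  exact lt_asymm h h2

theorem mem_closure_of_inversionParity_ne_zero {J : Set B} {w t : W}
    (hw : w ∈ Subgroup.closure (cs.simple '' J)) (h : cs.inversionParity w t ≠ 0) :
    t ∈ Subgroup.closure (cs.simple '' J) := by
  classical
  have key (x y : W) (hy : y ∈ Subgroup.closure (cs.simple '' J)) :
      y * x * y⁻¹ ∈ Subgroup.closure (cs.simple '' J) →
        x ∈ Subgroup.closure (cs.simple '' J) := fun hx ↦ by
    rwa [Subgroup.mul_mem_cancel_right _ (inv_mem hy), Subgroup.mul_mem_cancel_left _ hy] at hx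
  induction hw using Subgroup.closure_induction generalizing t with
  | mem x hx =>
    obtain ⟨j, hj, rfl⟩ := hx
    rw [inversionParity_simple] at h
    rw [show t = cs.simple j by by_contra ht; simp [ht] at h]
    exact Subgroup.subset_closure ⟨j, hj, rfl⟩
  | one => simp [inversionParity_one] at h
  | mul x y _ hy ihx ihy =>
    rw [inversionParity_mul] at h
    by_cases h0 : cs.inversionParity y t = 0
    · rw [h0, zero_add] at h
      exact key t y hy (ihx h)
    · exact ihy h0
  | inv x hx ih =>
    have h1 := cs.inversionParity_mul x x⁻¹ t
    rw [mul_inv_cancel, inversionParity_one] at h1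
    refine key t x⁻¹ (inv_mem hx) (ih fun h0 ↦ h ?_)
    rw [h0, add_zero] at h1
    exact h1.symm

end Inversions

section Parabolic

variable {J : Set B}

theorem length_mul_simple_of_mem_closure {w : W} (hw : w ∈ Subgroup.closure (cs.simple '' J))
    {i : B} (hi : i ∉ J) : cs.length (w * cs.simple i) = cs.length w + 1 := by
  rw [← not_isRightDescent_iff, isRightDescent_iff_inversionParity_ne_zero]
  exact fun h ↦ hi (cs.simple_mem_closure_iff.mp (cs.mem_closure_of_inversionParity_ne_zero hw h))

theorem length_simple_mul_of_mem_closure {w : W} (hw : w ∈ Subgroup.closure (cs.simple '' J))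
    {i : B} (hi : i ∉ J) : cs.length (cs.simple i * w) = cs.length w + 1 := by
  rw [← length_inv, mul_inv_rev, inv_simple, cs.length_mul_simple_of_mem_closure (inv_mem hw) hi,
    length_inv]

theorem eq_of_isRightDescent_mul_simple {v : W} (hv : v ∈ Subgroup.closure (cs.simple '' J))
    {s s' r : B} (hs' : s' ∉ J) (hss' : M s s' ≠ 2)
    (hdesc : ∀ j ∈ J, cs.IsRightDescent v j → j = s)
    (hr : cs.IsRightDescent (v * cs.simple s') r) : r = s' := by
  classical
  by_contra hne
  rw [isRightDescent_iff_inversionParity_ne_zero, inversionParity_mul, inversionParity_simple,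
    if_neg (fun h ↦ hne (cs.simple_injective h)), zero_add, inv_simple] at hr
  have hmem := cs.mem_closure_of_inversionParity_ne_zero hv hr
  have h2 := cs.eq_two_of_conj_simple_mem_closure hs' (Ne.symm hne) hmem
  rw [cs.simple_commute_of_eq_two h2] at hr hmem
  rw [hdesc r (cs.simple_mem_closure_iff.mp hmem)
    (cs.isRightDescent_iff_inversionParity_ne_zero.mpr hr), M.symmetric] at h2
  exact hss' h2

theorem not_weakLE_mul_simple {v w : W} (hv : v ∈ Subgroup.closure (cs.simple '' J))
    (hw : w ∈ Subgroup.closure (cs.simple '' J)) (hvw : w ≠ v)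
    {s s' : B} (hs' : s' ∉ J) (hss' : M s s' ≠ 2)
    (hdesc : ∀ j ∈ J, cs.IsRightDescent v j → j = s) :
    ¬ weakLE cs (w * cs.simple s') (v * cs.simple s') := by
  intro h
  rw [weakLE] at h
  set u := (w * cs.simple s')⁻¹ * (v * cs.simple s') with hu
  have hu1 : u ≠ 1 := fun h1 ↦ hvw (mul_right_cancel (inv_mul_eq_one.mp h1))
  have hwu : w * cs.simple s' * u = v * cs.simple s' := mul_inv_cancel_left _ _
  obtain ⟨r, hr⟩ := cs.exists_rightDescent_of_ne_one hu1
  have hr' : cs.IsRightDescent (v * cs.simple s') r := by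
    have h1 := cs.length_mul_le (w * cs.simple s') (u * cs.simple r)
    rw [← mul_assoc, hwu] at h1
    have h2 : cs.length (u * cs.simple r) < cs.length u := hr
    rw [IsRightDescent]
    omega
  obtain rfl := cs.eq_of_isRightDescent_mul_simple hv hs' hss' hdesc hr'
  rw [isRightDescent_iff] at hr
  have hus : u * cs.simple r = cs.simple r * (w⁻¹ * v) := by simp [hu, mul_assoc]
  rw [hus, cs.length_simple_mul_of_mem_closure (mul_mem (inv_mem hw) hv) hs'] at hr
  rw [cs.length_mul_simple_of_mem_closure hv hs', cs.length_mul_simple_of_mem_closure hw hs'] at h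
  have h3 := cs.length_mul_le w (w⁻¹ * v)
  rw [mul_inv_cancel_left] at h3
  omega

/-- If `W_K` is finite, then infinitely many elements of an infinite `W_J ⊇ W_K` have minimal
length in their coset modulo `W_K`. -/
theorem infinite_setOf_not_isRightDescent {K : Set B} (hKJ : K ⊆ J)
    (hJ : (Subgroup.closure (cs.simple '' J) : Set W).Infinite)
    (hK : (Subgroup.closure (cs.simple '' K) : Set W).Finite) :
    {w | w ∈ Subgroup.closure (cs.simple '' J) ∧ ∀ j ∈ K, ¬ cs.IsRightDescent w j}.Infinite := by
  intro hfin
  refine hJ ((hfin.image2 (· * ·) hK).subset fun w hw ↦ ?_)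
  have hne : ((fun y ↦ w * y) '' (Subgroup.closure (cs.simple '' K) : Set W)).Nonempty :=
    ⟨w * 1, 1, one_mem _, rfl⟩
  obtain ⟨_, ⟨y, hy, rfl⟩, hmin⟩ := exists_minimalFor_of_wellFoundedLT _ cs.length hne
  refine ⟨w * y, ⟨?_, fun j hj hdesc ↦ ?_⟩, y⁻¹, inv_mem hy, by simp⟩
  · exact mul_mem hw (Subgroup.closure_mono (Set.image_mono hKJ) hy)
  · have hmem : w * y * cs.simple j ∈
        (fun y ↦ w * y) '' (Subgroup.closure (cs.simple '' K) : Set W) :=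
      ⟨y * cs.simple j, mul_mem hy (Subgroup.subset_closure ⟨j, hj, rfl⟩), (mul_assoc _ _ _).symm⟩
    exact (hmin hmem hdesc.le).not_gt hdesc

end Parabolic

end CoxeterSystem

/-- If `(W,S)` is an irreducible Coxeter system (connected Coxeter diagram,
`S` finite) that is not locally finite, i.e. some proper standard parabolic
subgroup `W_J`, `J ⊊ S`, is infinite, then the right weak order on `W`
contains an infinite antichain. -/
theorem infinite_antichain_of_not_locally_finite {B : Type*} [Fintype B]
    {W : Type*} [Group W] {M : CoxeterMatrix B} (cs : CoxeterSystem M W)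
    (hirr : ∀ s t : B, Relation.ReflTransGen (fun a b => a ≠ b ∧ M a b ≠ 2) s t)
    (hnlf : ∃ J : Set B, J ≠ Set.univ ∧
      (Subgroup.closure (cs.simple '' J) : Set W).Infinite) :
    ∃ A : Set W, A.Infinite ∧ IsAntichain (weakLE cs) A := by
  obtain ⟨J, ⟨hJ, hinf⟩, hmin⟩ := exists_minimal_of_wellFoundedLT _ hnlf
  obtain ⟨t, ht⟩ := (Set.ne_univ_iff_exists_notMem J).mp hJ
  obtain ⟨s₀, hs₀⟩ : J.Nonempty := by
    by_contra h
    rw [Set.not_nonempty_iff_eq_empty] at h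
    simp [h] at hinf
  obtain ⟨s, hs, s', hs', hss'⟩ : ∃ s ∈ J, ∃ s' ∉ J, M s s' ≠ 2 := by
    by_contra! h
    refine ht ?_
    clear ht
    induction hirr s₀ t with
    | refl => exact hs₀
    | tail _ hab ih =>
      by_contra hb
      exact hab.2 (h _ ih _ hb)
  have hfin : (Subgroup.closure (cs.simple '' (J \ {s})) : Set W).Finite := by
    by_contra h
    have := hmin (y := J \ {s}) ⟨fun h1 ↦ ht (h1.symm ▸ Set.mem_univ t : t ∈ J \ {s}).1, h⟩
      Set.sdiff_subset hs
    exact this.2 rfl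
  refine ⟨(· * cs.simple s') '' _, (cs.infinite_setOf_not_isRightDescent Set.sdiff_subset hinf
    hfin).image (mul_left_injective _).injOn, ?_⟩
  rintro _ ⟨w, ⟨hw, -⟩, rfl⟩ _ ⟨v, ⟨hv, hdesc⟩, rfl⟩ hne
  refine cs.not_weakLE_mul_simple hv hw (fun h ↦ hne (h ▸ rfl)) hs' hss' fun j hj hjv ↦ ?_
  by_contra hjs
  exact hdesc j ⟨hj, hjs⟩ hjv
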